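/- arXiv:1907.01450 — 2 statements merged into one kernel-verified Lean document; each statement's English description precedes it below -/
import Mathlib

section
/- Let (Ω, 𝓕, (𝓕_t)_{t≥0}, ℙ) be a filtered probability space, H a separable real Hilbert space, T > 0, and M = (M_t)_{t∈[0,T]} a real-valued martingale with 𝔼[M_t²] < ∞ for all t. Let A = (A_t)_{t∈[0,T]} be an adapted, integrable real-valued process with A_0 = 0 and nondecreasing sample paths such that (M_t² − A_t)_{t∈[0,T]} is a martingale. Let 0 = t_1 < t_2 < … < t_{n+1} = T and for each i = 1, …, n let X_i : Ω → H be a bounded 𝓕_{t_i}-measurable random variable. Then the following Itô isometry for simple processes holds: 𝔼[‖Σ_{i=1}^n X_i (M_{t_{i+1}} − M_{t_i})‖_H²] = 𝔼[Σ_{i=1}^n ‖X_i‖_H² (A_{t_{i+1}} − A_{t_i})]. -/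
open MeasureTheory Filter Set
open scoped RealInnerProductSpace

/-- An integrable function with vanishing conditional expectation is orthogonal to every function
measurable with respect to the conditioning σ-algebra. -/
theorem integral_mul_eq_zero_of_condExp_eq_zero {Ω : Type*} {m m₀ : MeasurableSpace Ω}
    {μ : Measure Ω} [IsFiniteMeasure μ] (hm : m ≤ m₀) {f g : Ω → ℝ}
    (hf : StronglyMeasurable[m] f) (hg : Integrable g μ)
    (hfg : Integrable (fun ω => f ω * g ω) μ) (h0 : μ[g | m] =ᵐ[μ] 0) :
    ∫ ω, f ω * g ω ∂μ = 0 := by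
  have h := condExp_mul_of_stronglyMeasurable_left (m := m) hf hfg hg
  rw [← integral_condExp hm, ← integral_zero Ω ℝ (μ := μ)]
  refine integral_congr_ae ?_
  filter_upwards [h, h0] with ω h1 h2
  exact h1.trans (by simp [h2])

/-- A martingale increment has vanishing conditional expectation. -/
theorem condExp_sub_eq_zero_of_condExp_eq {Ω : Type*} {m m₀ : MeasurableSpace Ω}
    {μ : Measure Ω} [IsFiniteMeasure μ] (hm : m ≤ m₀) {f g : Ω → ℝ}
    (hf : StronglyMeasurable[m] f) (hfi : Integrable f μ) (hgi : Integrable g μ)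
    (h : μ[g | m] =ᵐ[μ] f) : μ[fun ω => g ω - f ω | m] =ᵐ[μ] 0 := by
  have h1 := condExp_sub hgi hfi m
  rw [condExp_of_stronglyMeasurable hm hf hfi] at h1
  filter_upwards [h1, h] with ω h1 h2
  exact h1.trans (by simp [h2])

/-- Weighted isometry over a single time step: the squared increment of `M` and the increment of
its compensator have the same integral against bounded past-measurable weights. -/
theorem integral_mul_sq_increment_eq {Ω : Type*} {m m₀ : MeasurableSpace Ω}
    {μ : Measure Ω} [IsFiniteMeasure μ] (hm : m ≤ m₀) {f M M' A A' : Ω → ℝ}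
    (hf : StronglyMeasurable[m] f) {C : ℝ} (hfC : ∀ ω, ‖f ω‖ ≤ C)
    (hM : StronglyMeasurable[m] M) (hA : StronglyMeasurable[m] A)
    (hML : MemLp M 2 μ) (hML' : MemLp M' 2 μ) (hAi : Integrable A μ) (hAi' : Integrable A' μ)
    (hmart : μ[M' | m] =ᵐ[μ] M)
    (hcomp : μ[fun ω => M' ω ^ 2 - A' ω | m] =ᵐ[μ] fun ω => M ω ^ 2 - A ω) :
    ∫ ω, f ω * (M' ω - M ω) ^ 2 ∂μ = ∫ ω, f ω * (A' ω - A ω) ∂μ := by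
  have hbdd {g : Ω → ℝ} (hg : Integrable g μ) : Integrable (fun ω => f ω * g ω) μ :=
    hg.bdd_mul (hf.mono hm).aestronglyMeasurable (.of_forall hfC)
  have hN : Integrable (fun ω => M ω ^ 2 - A ω) μ := hML.integrable_sq.sub hAi
  have hN' : Integrable (fun ω => M' ω ^ 2 - A' ω) μ := hML'.integrable_sq.sub hAi'
  have hdM : MemLp (fun ω => M' ω - M ω) 2 μ := hML'.sub hML
  have hMdM : Integrable (fun ω => M ω * (M' ω - M ω)) μ := hML.integrable_mul hdM
  have hNf := hbdd (hN'.sub hN)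
  have hMf : Integrable (fun ω => f ω * M ω * (M' ω - M ω)) μ := by
    simpa only [mul_assoc] using hbdd hMdM
  have hAf := hbdd (hAi'.sub hAi)
  simp only [Pi.sub_apply] at hNf hAf
  have e1 := integral_mul_eq_zero_of_condExp_eq_zero hm hf (hN'.sub hN) hNf
    (condExp_sub_eq_zero_of_condExp_eq hm ((hM.pow 2).sub hA) hN hN' hcomp)
  have e2 := integral_mul_eq_zero_of_condExp_eq_zero hm (hf.mul hM)
    (hdM.integrable one_le_two) hMf
    (condExp_sub_eq_zero_of_condExp_eq hm hM (hML.integrable one_le_two)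
      (hML'.integrable one_le_two) hmart)
  simp only [Pi.sub_apply, Pi.mul_apply] at e1 e2
  calc ∫ ω, f ω * (M' ω - M ω) ^ 2 ∂μ
      = ∫ ω, (f ω * (M' ω ^ 2 - A' ω - (M ω ^ 2 - A ω))
          - 2 * (f ω * M ω * (M' ω - M ω))) + f ω * (A' ω - A ω) ∂μ := by
        congr 1 with ω
        ring
    _ = ∫ ω, f ω * (A' ω - A ω) ∂μ := by
        rw [integral_add (by exact hNf.sub (hMf.const_mul 2)) hAf, integral_sub hNf (hMf.const_mul 2),
          integral_const_mul, e1, e2]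
        simp

/-- Itô isometry for simple processes: if `M` is a real-valued
square-integrable martingale on `[0,T]` with compensator `A` (so `M² − A` is a
martingale, `A` adapted, integrable, starting at `0`, with nondecreasing paths), and
`X_i` are bounded `𝓕_{t_i}`-measurable `H`-valued random variables for a partition
`0 = t_1 < … < t_{n+1} = T`, then
`𝔼[‖∑ X_i (M_{t_{i+1}} − M_{t_i})‖²] = 𝔼[∑ ‖X_i‖² (A_{t_{i+1}} − A_{t_i})]`. -/
theorem ito_isometry_simple
    {Ω H : Type*} {m : MeasurableSpace Ω} (μ : Measure Ω) [IsProbabilityMeasure μ]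
    [NormedAddCommGroup H] [InnerProductSpace ℝ H] [CompleteSpace H]
    [TopologicalSpace.SeparableSpace H]
    (𝓕 : MeasureTheory.Filtration ℝ m) (T : ℝ) (hT : 0 < T)
    (M A : ℝ → Ω → ℝ)
    -- `M` is a square-integrable martingale on `[0,T]`:
    (hMadapted : ∀ t ∈ Icc (0 : ℝ) T, StronglyMeasurable[𝓕 t] (M t))
    (hMsq : ∀ t ∈ Icc (0 : ℝ) T, Integrable (fun ω => (M t ω) ^ 2) μ)
    (hMmart : ∀ s t : ℝ, 0 ≤ s → s ≤ t → t ≤ T → μ[M t | 𝓕 s] =ᵐ[μ] M s)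
    -- `A` is adapted, integrable, starts at `0`, and has nondecreasing sample paths:
    (hAadapted : ∀ t ∈ Icc (0 : ℝ) T, StronglyMeasurable[𝓕 t] (A t))
    (hAint : ∀ t ∈ Icc (0 : ℝ) T, Integrable (A t) μ)
    (hA0 : ∀ ω, A 0 ω = 0)
    (hAmono : ∀ ω, ∀ s t : ℝ, 0 ≤ s → s ≤ t → t ≤ T → A s ω ≤ A t ω)
    -- `M² − A` is a martingale on `[0,T]`:
    (hMA : ∀ s t : ℝ, 0 ≤ s → s ≤ t → t ≤ T →
      μ[fun ω => (M t ω) ^ 2 - A t ω | 𝓕 s] =ᵐ[μ] fun ω => (M s ω) ^ 2 - A s ω)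
    -- the partition `0 = t_1 < t_2 < … < t_{n+1} = T`:
    (n : ℕ) (τ : Fin (n + 1) → ℝ) (hτ : StrictMono τ)
    (hτ0 : τ 0 = 0) (hτT : τ (Fin.last n) = T)
    -- the bounded `𝓕_{t_i}`-measurable random variables `X_i`:
    (X : Fin n → Ω → H)
    (hXmeas : ∀ i : Fin n, StronglyMeasurable[𝓕 (τ i.castSucc)] (X i))
    (hXbdd : ∀ i : Fin n, ∃ C : ℝ, ∀ ω, ‖X i ω‖ ≤ C) :
    ∫ ω, ‖∑ i : Fin n, (M (τ i.succ) ω - M (τ i.castSucc) ω) • X i ω‖ ^ 2 ∂μ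
      = ∫ ω, ∑ i : Fin n, ‖X i ω‖ ^ 2 * (A (τ i.succ) ω - A (τ i.castSucc) ω) ∂μ := by
  have hmem (i : Fin (n + 1)) : τ i ∈ Icc (0 : ℝ) T :=
    ⟨hτ0 ▸ hτ.monotone (Fin.zero_le i), hτT ▸ hτ.monotone (Fin.le_last i)⟩
  have hML (i : Fin (n + 1)) : MemLp (M (τ i)) 2 μ :=
    (memLp_two_iff_integrable_sq
      ((hMadapted _ (hmem i)).mono (𝓕.le _)).aestronglyMeasurable).2 (hMsq _ (hmem i))
  have hstep (i : Fin n) : τ i.castSucc ≤ τ i.succ := hτ.monotone i.castSucc_lt_succ.le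
  have hD (i : Fin n) : MemLp (fun ω => M (τ i.succ) ω - M (τ i.castSucc) ω) 2 μ :=
    (hML _).sub (hML _)
  have hD0 (i : Fin n) :
      μ[fun ω => M (τ i.succ) ω - M (τ i.castSucc) ω | 𝓕 (τ i.castSucc)] =ᵐ[μ] 0 :=
    condExp_sub_eq_zero_of_condExp_eq (𝓕.le _) (hMadapted _ (hmem _))
      ((hML _).integrable one_le_two) ((hML _).integrable one_le_two)
      (hMmart _ _ (hmem _).1 (hstep i) (hmem _).2)
  choose C hC using hXbdd
  have hXX (i j : Fin n) (ω : Ω) : ‖⟪X i ω, X j ω⟫‖ ≤ C i * C j :=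
    (norm_inner_le_norm _ _).trans
      (mul_le_mul (hC i ω) (hC j ω) (norm_nonneg _) ((norm_nonneg _).trans (hC i ω)))
  have hXXm (i j : Fin n) : AEStronglyMeasurable (fun ω => ⟪X i ω, X j ω⟫) μ :=
    (((hXmeas i).mono (𝓕.le _)).inner ((hXmeas j).mono (𝓕.le _))).aestronglyMeasurable
  have hprod (i j : Fin n) : Integrable (fun ω => ⟪X i ω, X j ω⟫ *
      ((M (τ i.succ) ω - M (τ i.castSucc) ω) * (M (τ j.succ) ω - M (τ j.castSucc) ω))) μ :=
    ((hD i).integrable_mul (hD j)).bdd_mul (hXXm i j) (.of_forall (hXX i j))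
  have hcross_lt (i j : Fin n) (hij : i < j) : ∫ ω, ⟪X i ω, X j ω⟫ *
      ((M (τ i.succ) ω - M (τ i.castSucc) ω) * (M (τ j.succ) ω - M (τ j.castSucc) ω)) ∂μ = 0 := by
    have hle : τ i.succ ≤ τ j.castSucc := hτ.monotone (Fin.succ_le_castSucc_iff.2 hij)
    have hle' := (hstep i).trans hle
    have hi := hprod i j
    simp only [← mul_assoc] at hi ⊢
    exact integral_mul_eq_zero_of_condExp_eq_zero (𝓕.le _)
      ((((hXmeas i).mono (𝓕.mono hle')).inner (hXmeas j)).mul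
        (((hMadapted _ (hmem _)).mono (𝓕.mono hle)).sub
          ((hMadapted _ (hmem _)).mono (𝓕.mono hle'))))
      ((hD j).integrable one_le_two) hi (hD0 j)
  have hcross (i j : Fin n) (hij : j ≠ i) : ∫ ω, ⟪X i ω, X j ω⟫ *
      ((M (τ i.succ) ω - M (τ i.castSucc) ω) * (M (τ j.succ) ω - M (τ j.castSucc) ω)) ∂μ = 0 := by
    rcases hij.lt_or_gt with h | h
    · rw [← hcross_lt j i h]
      congr 1 with ω
      rw [real_inner_comm, mul_comm (M (τ i.succ) ω - _)]
    · exact hcross_lt i j h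
  have hnormsq (i : Fin n) (ω : Ω) : ‖‖X i ω‖ ^ 2‖ ≤ C i * C i := by
    simpa only [real_inner_self_eq_norm_sq] using hXX i i ω
  have hdiag (i : Fin n) : ∫ ω, ⟪X i ω, X i ω⟫ *
      ((M (τ i.succ) ω - M (τ i.castSucc) ω) * (M (τ i.succ) ω - M (τ i.castSucc) ω)) ∂μ
      = ∫ ω, ‖X i ω‖ ^ 2 * (A (τ i.succ) ω - A (τ i.castSucc) ω) ∂μ := by
    simp only [real_inner_self_eq_norm_sq, ← pow_two]
    exact integral_mul_sq_increment_eq (𝓕.le _) ((hXmeas i).norm.pow 2) (hnormsq i)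
      (hMadapted _ (hmem _)) (hAadapted _ (hmem _)) (hML _) (hML _) (hAint _ (hmem _))
      (hAint _ (hmem _)) (hMmart _ _ (hmem _).1 (hstep i) (hmem _).2)
      (hMA _ _ (hmem _).1 (hstep i) (hmem _).2)
  calc ∫ ω, ‖∑ i : Fin n, (M (τ i.succ) ω - M (τ i.castSucc) ω) • X i ω‖ ^ 2 ∂μ
      = ∫ ω, ∑ i : Fin n, ∑ j : Fin n, ⟪X i ω, X j ω⟫ *
          ((M (τ i.succ) ω - M (τ i.castSucc) ω) *
            (M (τ j.succ) ω - M (τ j.castSucc) ω)) ∂μ := by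
        congr 1 with ω
        rw [← real_inner_self_eq_norm_sq, sum_inner]
        refine Finset.sum_congr rfl fun i _ => ?_
        rw [inner_sum]
        refine Finset.sum_congr rfl fun j _ => ?_
        rw [real_inner_smul_left, real_inner_smul_right]
        ring
    _ = ∑ i : Fin n, ∑ j : Fin n, ∫ ω, ⟪X i ω, X j ω⟫ *
          ((M (τ i.succ) ω - M (τ i.castSucc) ω) *
            (M (τ j.succ) ω - M (τ j.castSucc) ω)) ∂μ := by
        rw [integral_finsetSum _ fun i _ => integrable_finsetSum _ fun j _ => hprod i j]
        exact Finset.sum_congr rfl fun i _ => integral_finsetSum _ fun j _ => hprod i j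
    _ = ∑ i : Fin n, ∫ ω, ‖X i ω‖ ^ 2 * (A (τ i.succ) ω - A (τ i.castSucc) ω) ∂μ := by
        refine Finset.sum_congr rfl fun i _ => ?_
        rw [Finset.sum_eq_single i (fun j _ hj => hcross i j hj) (by simp), hdiag]
    _ = ∫ ω, ∑ i : Fin n, ‖X i ω‖ ^ 2 * (A (τ i.succ) ω - A (τ i.castSucc) ω) ∂μ := by
        refine (integral_finsetSum _ fun i _ => ?_).symm
        exact ((hAint _ (hmem _)).sub (hAint _ (hmem _))).bdd_mul
          (((hXmeas i).mono (𝓕.le _)).norm.pow 2).aestronglyMeasurable (.of_forall (hnormsq i))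
end

section
/- Let (Ω, 𝓕, (𝓕_t)_{t≥0}, ℙ) be a filtered probability space, H a separable real Hilbert space, T > 0, and let M = (M_t)_{t∈[0,T]} and N = (N_t)_{t∈[0,T]} be real-valued martingales with 𝔼[M_t²] < ∞ and 𝔼[N_t²] < ∞ for all t. Let C = (C_t)_{t∈[0,T]} be an adapted, integrable real-valued process with C_0 = 0 such that (M_t N_t − C_t)_{t∈[0,T]} is a martingale. Let 0 = t_1 < t_2 < … < t_{n+1} = T and for each i = 1, …, n let X_i, Y_i : Ω → H be bounded 𝓕_{t_i}-measurable random variables. Then 𝔼[⟨Σ_{i=1}^n X_i (M_{t_{i+1}} − M_{t_i}), Σ_{i=1}^n Y_i (N_{t_{i+1}} − N_{t_i})⟩_H] = 𝔼[Σ_{i=1}^n ⟨X_i, Y_i⟩_H (C_{t_{i+1}} − C_{t_i})]. -/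
open MeasureTheory Filter Set
open scoped RealInnerProductSpace

/-- The increment of a martingale is orthogonal to every random variable known beforehand. -/
theorem integral_mul_increment_eq_zero {Ω : Type*} {m' m : MeasurableSpace Ω} {μ : Measure Ω}
    [IsFiniteMeasure μ] (hm : m' ≤ m) {V f g : Ω → ℝ} (hV : StronglyMeasurable[m'] V)
    (hg : StronglyMeasurable[m'] g) (hf_int : Integrable f μ) (hg_int : Integrable g μ)
    (hfg : μ[f | m'] =ᵐ[μ] g) (hVfg : Integrable (fun ω => V ω * (f ω - g ω)) μ) :
    ∫ ω, V ω * (f ω - g ω) ∂μ = 0 := by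
  have hcond : μ[f - g | m'] =ᵐ[μ] 0 := by
    filter_upwards [condExp_sub hf_int hg_int m', hfg] with ω h₁ h₂
    rw [h₁, Pi.sub_apply, h₂, condExp_of_stronglyMeasurable hm hg hg_int]
    simp
  have hpull : μ[V * (f - g) | m'] =ᵐ[μ] 0 := by
    filter_upwards [condExp_mul_of_stronglyMeasurable_left hV hVfg (hf_int.sub hg_int), hcond]
      with ω h₁ h₂
    exact h₁.trans (by rw [Pi.mul_apply]; exact mul_eq_zero_of_right _ h₂)
  calc ∫ ω, V ω * (f ω - g ω) ∂μ = ∫ ω, (μ[V * (f - g) | m']) ω ∂μ :=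
        (integral_condExp hm).symm
    _ = 0 := by rw [integral_congr_ae hpull]; simp

/-- The inner product of two bounded random variables is a bounded multiplier of `L¹`. -/
theorem Integrable.inner_bdd_mul {Ω H : Type*} {m : MeasurableSpace Ω} {μ : Measure Ω}
    [NormedAddCommGroup H] [InnerProductSpace ℝ H] {X Y : Ω → H}
    (hX : StronglyMeasurable X) (hY : StronglyMeasurable Y) (hXb : ∃ c : ℝ, ∀ ω, ‖X ω‖ ≤ c)
    (hYb : ∃ c : ℝ, ∀ ω, ‖Y ω‖ ≤ c) {f : Ω → ℝ} (hf : Integrable f μ) :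
    Integrable (fun ω => ⟪X ω, Y ω⟫ * f ω) μ := by
  obtain ⟨a, ha⟩ := hXb
  obtain ⟨b, hb⟩ := hYb
  refine hf.bdd_mul (c := a * b) (hX.inner hY).aestronglyMeasurable (ae_of_all _ fun ω => ?_)
  exact (norm_inner_le_norm _ _).trans
    (mul_le_mul (ha ω) (hb ω) (norm_nonneg _) ((norm_nonneg _).trans (ha ω)))

/-- Polarized Itô isometry for simple processes: if `M, N` are
real-valued square-integrable martingales on `[0,T]` and `C` is an adapted integrable
process with `C_0 = 0` such that `M N − C` is a martingale, then for bounded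
`𝓕_{t_i}`-measurable `H`-valued random variables `X_i, Y_i` over a partition
`0 = t_1 < … < t_{n+1} = T` one has
`𝔼[⟨∑ X_i (M_{t_{i+1}} − M_{t_i}), ∑ Y_i (N_{t_{i+1}} − N_{t_i})⟩]
  = 𝔼[∑ ⟨X_i, Y_i⟩ (C_{t_{i+1}} − C_{t_i})]`. -/
theorem ito_isometry_polarized_simple
    {Ω H : Type*} {m : MeasurableSpace Ω} (μ : Measure Ω) [IsProbabilityMeasure μ]
    [NormedAddCommGroup H] [InnerProductSpace ℝ H] [CompleteSpace H]
    [TopologicalSpace.SeparableSpace H]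
    (𝓕 : MeasureTheory.Filtration ℝ m) (T : ℝ) (hT : 0 < T)
    (M N C : ℝ → Ω → ℝ)
    -- `M` is a square-integrable martingale on `[0,T]`:
    (hMadapted : ∀ t ∈ Icc (0 : ℝ) T, StronglyMeasurable[𝓕 t] (M t))
    (hMsq : ∀ t ∈ Icc (0 : ℝ) T, Integrable (fun ω => (M t ω) ^ 2) μ)
    (hMmart : ∀ s t : ℝ, 0 ≤ s → s ≤ t → t ≤ T → μ[M t | 𝓕 s] =ᵐ[μ] M s)
    -- `N` is a square-integrable martingale on `[0,T]`:
    (hNadapted : ∀ t ∈ Icc (0 : ℝ) T, StronglyMeasurable[𝓕 t] (N t))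
    (hNsq : ∀ t ∈ Icc (0 : ℝ) T, Integrable (fun ω => (N t ω) ^ 2) μ)
    (hNmart : ∀ s t : ℝ, 0 ≤ s → s ≤ t → t ≤ T → μ[N t | 𝓕 s] =ᵐ[μ] N s)
    -- `C` is adapted, integrable and starts at `0`:
    (hCadapted : ∀ t ∈ Icc (0 : ℝ) T, StronglyMeasurable[𝓕 t] (C t))
    (hCint : ∀ t ∈ Icc (0 : ℝ) T, Integrable (C t) μ)
    (hC0 : ∀ ω, C 0 ω = 0)
    -- `M N − C` is a martingale on `[0,T]`:
    (hMNC : ∀ s t : ℝ, 0 ≤ s → s ≤ t → t ≤ T →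
      μ[fun ω => M t ω * N t ω - C t ω | 𝓕 s] =ᵐ[μ] fun ω => M s ω * N s ω - C s ω)
    -- the partition `0 = t_1 < t_2 < … < t_{n+1} = T`:
    (n : ℕ) (τ : Fin (n + 1) → ℝ) (hτ : StrictMono τ)
    (hτ0 : τ 0 = 0) (hτT : τ (Fin.last n) = T)
    -- the bounded `𝓕_{t_i}`-measurable random variables `X_i`, `Y_i`:
    (X Y : Fin n → Ω → H)
    (hXmeas : ∀ i : Fin n, StronglyMeasurable[𝓕 (τ i.castSucc)] (X i))
    (hXbdd : ∀ i : Fin n, ∃ Cb : ℝ, ∀ ω, ‖X i ω‖ ≤ Cb)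
    (hYmeas : ∀ i : Fin n, StronglyMeasurable[𝓕 (τ i.castSucc)] (Y i))
    (hYbdd : ∀ i : Fin n, ∃ Cb : ℝ, ∀ ω, ‖Y i ω‖ ≤ Cb) :
    ∫ ω, ⟪∑ i : Fin n, (M (τ i.succ) ω - M (τ i.castSucc) ω) • X i ω,
          ∑ i : Fin n, (N (τ i.succ) ω - N (τ i.castSucc) ω) • Y i ω⟫ ∂μ
      = ∫ ω, ∑ i : Fin n, ⟪X i ω, Y i ω⟫ * (C (τ i.succ) ω - C (τ i.castSucc) ω) ∂μ := by
  have hmem : ∀ i, τ i ∈ Icc (0 : ℝ) T := fun i =>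
    ⟨hτ0 ▸ hτ.monotone (Fin.zero_le i), hτT ▸ hτ.monotone (Fin.le_last i)⟩
  have hstep : ∀ i : Fin n, τ i.castSucc ≤ τ i.succ := fun i =>
    hτ.monotone i.castSucc_lt_succ.le
  have hML : ∀ i, MemLp (M (τ i)) 2 μ := fun i =>
    (memLp_two_iff_integrable_sq
      ((hMadapted _ (hmem i)).mono (𝓕.le _)).aestronglyMeasurable).2 (hMsq _ (hmem i))
  have hNL : ∀ i, MemLp (N (τ i)) 2 μ := fun i =>
    (memLp_two_iff_integrable_sq
      ((hNadapted _ (hmem i)).mono (𝓕.le _)).aestronglyMeasurable).2 (hNsq _ (hmem i))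
  have hMi : ∀ i, Integrable (M (τ i)) μ := fun i => (hML i).integrable one_le_two
  have hNi : ∀ i, Integrable (N (τ i)) μ := fun i => (hNL i).integrable one_le_two
  have hCi : ∀ i, Integrable (C (τ i)) μ := fun i => hCint _ (hmem i)
  have hMm : ∀ i, StronglyMeasurable[𝓕 (τ i)] (M (τ i)) := fun i => hMadapted _ (hmem i)
  have hNm : ∀ i, StronglyMeasurable[𝓕 (τ i)] (N (τ i)) := fun i => hNadapted _ (hmem i)
  have hle : ∀ {i j : Fin (n + 1)}, i ≤ j → 𝓕 (τ i) ≤ 𝓕 (τ j) := fun h =>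
    𝓕.mono (hτ.monotone h)
  have hbdd : ∀ (i j : Fin n) {f : Ω → ℝ}, Integrable f μ →
      Integrable (fun ω => ⟪X i ω, Y j ω⟫ * f ω) μ := fun i j f hf =>
    Integrable.inner_bdd_mul ((hXmeas i).mono (𝓕.le _)) ((hYmeas j).mono (𝓕.le _))
      (hXbdd i) (hYbdd j) hf
  have hterm : ∀ i j : Fin n, Integrable (fun ω => ⟪X i ω, Y j ω⟫ *
      ((M (τ i.succ) ω - M (τ i.castSucc) ω) * (N (τ j.succ) ω - N (τ j.castSucc) ω))) μ :=
    fun i j => hbdd i j (((hML _).sub (hML _)).integrable_mul ((hNL _).sub (hNL _)))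
  have hoff : ∀ i j : Fin n, j ≠ i → ∫ ω, ⟪X i ω, Y j ω⟫ *
      ((M (τ i.succ) ω - M (τ i.castSucc) ω) * (N (τ j.succ) ω - N (τ j.castSucc) ω)) ∂μ = 0 := by
    intro i j hne
    rcases lt_or_gt_of_ne hne with hji | hij
    · have h₁ : j.castSucc ≤ i.castSucc := hji.le
      have h₂ : j.succ ≤ i.castSucc := hji
      have key := integral_mul_increment_eq_zero (μ := μ) (𝓕.le (τ i.castSucc))
        (V := fun ω => ⟪X i ω, Y j ω⟫ * (N (τ j.succ) ω - N (τ j.castSucc) ω))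
        (((hXmeas i).inner ((hYmeas j).mono (hle h₁))).mul
          (((hNm _).mono (hle h₂)).sub ((hNm _).mono (hle h₁))))
        (hMm _) (hMi i.succ) (hMi _) (hMmart _ _ (hmem _).1 (hstep i) (hmem _).2)
        ((hterm i j).congr (ae_of_all _ fun ω => by ring))
      rw [← key]
      exact integral_congr_ae (ae_of_all _ fun ω => by ring)
    · have h₁ : i.castSucc ≤ j.castSucc := hij.le
      have h₂ : i.succ ≤ j.castSucc := hij
      have key := integral_mul_increment_eq_zero (μ := μ) (𝓕.le (τ j.castSucc))
        (V := fun ω => ⟪X i ω, Y j ω⟫ * (M (τ i.succ) ω - M (τ i.castSucc) ω))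
        ((((hXmeas i).mono (hle h₁)).inner (hYmeas j)).mul
          (((hMm _).mono (hle h₂)).sub ((hMm _).mono (hle h₁))))
        (hNm _) (hNi j.succ) (hNi _) (hNmart _ _ (hmem _).1 (hstep j) (hmem _).2)
        ((hterm i j).congr (ae_of_all _ fun ω => by ring))
      rw [← key]
      exact integral_congr_ae (ae_of_all _ fun ω => by ring)
  have hdiag : ∀ i : Fin n, ∫ ω, ⟪X i ω, Y i ω⟫ *
      ((M (τ i.succ) ω - M (τ i.castSucc) ω) * (N (τ i.succ) ω - N (τ i.castSucc) ω)) ∂μ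
      = ∫ ω, ⟪X i ω, Y i ω⟫ * (C (τ i.succ) ω - C (τ i.castSucc) ω) ∂μ := by
    intro i
    have hXY := (hXmeas i).inner (𝕜 := ℝ) (hYmeas i)
    have hPi : ∀ k, Integrable (fun ω => M (τ k) ω * N (τ k) ω - C (τ k) ω) μ := fun k =>
      ((hML k).integrable_mul (hNL k)).sub (hCi k)
    have hiP : Integrable (fun ω => ⟪X i ω, Y i ω⟫ *
        ((M (τ i.succ) ω * N (τ i.succ) ω - C (τ i.succ) ω) -
          (M (τ i.castSucc) ω * N (τ i.castSucc) ω - C (τ i.castSucc) ω))) μ :=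
      hbdd i i ((hPi i.succ).sub (hPi i.castSucc))
    have hiN : Integrable (fun ω => ⟪X i ω, Y i ω⟫ * M (τ i.castSucc) ω *
        (N (τ i.succ) ω - N (τ i.castSucc) ω)) μ :=
      (hbdd i i ((hML i.castSucc).integrable_mul ((hNL i.succ).sub (hNL i.castSucc)))).congr
        (ae_of_all _ fun ω => by simp [mul_assoc])
    have hiM : Integrable (fun ω => ⟪X i ω, Y i ω⟫ * N (τ i.castSucc) ω *
        (M (τ i.succ) ω - M (τ i.castSucc) ω)) μ :=
      (hbdd i i ((hNL i.castSucc).integrable_mul ((hML i.succ).sub (hML i.castSucc)))).congr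
        (ae_of_all _ fun ω => by simp [mul_assoc])
    have hiC : Integrable (fun ω => ⟪X i ω, Y i ω⟫ *
        (C (τ i.succ) ω - C (τ i.castSucc) ω)) μ :=
      hbdd i i ((hCi i.succ).sub (hCi i.castSucc))
    have zP := integral_mul_increment_eq_zero (𝓕.le _) hXY
      (((hMm _).mul (hNm _)).sub (hCadapted _ (hmem _))) (hPi i.succ) (hPi i.castSucc)
      (hMNC _ _ (hmem _).1 (hstep i) (hmem _).2) hiP
    have zN := integral_mul_increment_eq_zero (𝓕.le _) (hXY.mul (hMm i.castSucc))
      (hNm _) (hNi i.succ) (hNi _) (hNmart _ _ (hmem _).1 (hstep i) (hmem _).2) hiN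
    have zM := integral_mul_increment_eq_zero (𝓕.le _) (hXY.mul (hNm i.castSucc))
      (hMm _) (hMi i.succ) (hMi _) (hMmart _ _ (hmem _).1 (hstep i) (hmem _).2) hiM
    rw [← sub_eq_zero, ← integral_sub (hterm i i) hiC]
    calc _ = ∫ ω, (⟪X i ω, Y i ω⟫ * ((M (τ i.succ) ω * N (τ i.succ) ω - C (τ i.succ) ω) -
              (M (τ i.castSucc) ω * N (τ i.castSucc) ω - C (τ i.castSucc) ω)) -
            ⟪X i ω, Y i ω⟫ * M (τ i.castSucc) ω * (N (τ i.succ) ω - N (τ i.castSucc) ω)) -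
            ⟪X i ω, Y i ω⟫ * N (τ i.castSucc) ω * (M (τ i.succ) ω - M (τ i.castSucc) ω) ∂μ :=
          integral_congr_ae (ae_of_all _ fun ω => by ring)
      _ = 0 := by
          refine (integral_sub (hiP.sub hiN) hiM).trans ?_
          refine (congrArg₂ _ ((integral_sub hiP hiN).trans (congrArg₂ _ zP zN)) zM).trans ?_
          simp
  calc _ = ∫ ω, ∑ i : Fin n, ∑ j : Fin n, ⟪X i ω, Y j ω⟫ *
        ((M (τ i.succ) ω - M (τ i.castSucc) ω) * (N (τ j.succ) ω - N (τ j.castSucc) ω)) ∂μ := by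
        refine integral_congr_ae (ae_of_all _ fun ω => ?_)
        simp only [sum_inner]
        simp only [inner_sum, real_inner_smul_left, real_inner_smul_right]
        exact Finset.sum_congr rfl fun i _ => Finset.sum_congr rfl fun j _ => by ring
    _ = ∑ i : Fin n, ∑ j : Fin n, ∫ ω, ⟪X i ω, Y j ω⟫ *
        ((M (τ i.succ) ω - M (τ i.castSucc) ω) * (N (τ j.succ) ω - N (τ j.castSucc) ω)) ∂μ := by
        rw [integral_finsetSum _ fun i _ => integrable_finsetSum _ fun j _ => hterm i j]
        exact Finset.sum_congr rfl fun i _ => integral_finsetSum _ fun j _ => hterm i j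
    _ = ∑ i : Fin n, ∫ ω, ⟪X i ω, Y i ω⟫ * (C (τ i.succ) ω - C (τ i.castSucc) ω) ∂μ :=
        Finset.sum_congr rfl fun i _ => by
          rw [Finset.sum_eq_single i (fun j _ hj => hoff i j hj) (by simp), hdiag i]
    _ = _ := (integral_finsetSum _ fun i _ =>
        hbdd i i ((hCi i.succ).sub (hCi i.castSucc))).symm
end
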